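/- Let C be a prevariety of languages over a finite alphabet A. Then the unambiguous polynomial closure of C equals the intersected polynomial closure of C: UPol(C) = Pol(C) ∩ coPol(C). That is, a language L belongs to UPol(C) if and only if both L and its complement A* \ L belong to Pol(C). -/

import Mathlib

/- Common definitions: languages over a finite alphabet, classes of languages,
prevarieties, polynomial closure and its variants, separation, C-pairs, etc. -/

namespace RegLang

variable {A : Type}

/-- A language over the alphabet `A`: a set of finite words. -/
abbrev Lang (A : Type) := Set (FreeMonoid A)

/-- A class of languages over the alphabet `A`. -/
abbrev LangClass (A : Type) := Set (Lang A)

/-- A lattice of languages: contains `∅` and `A*` and is closed under binary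
union and intersection. -/
def IsLatticeClass (C : LangClass A) : Prop :=
  ∅ ∈ C ∧ (Set.univ : Lang A) ∈ C ∧
    (∀ K L : Lang A, K ∈ C → L ∈ C → K ∪ L ∈ C) ∧
    (∀ K L : Lang A, K ∈ C → L ∈ C → K ∩ L ∈ C)

/-- A Boolean algebra of languages: a lattice of languages closed under complement. -/
def IsBooleanAlgebraClass (C : LangClass A) : Prop :=
  IsLatticeClass C ∧ ∀ L ∈ C, Lᶜ ∈ C

/-- A class is quotient-closed if it is closed under left and right quotients by words. -/
def QuotientClosed (C : LangClass A) : Prop :=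
  ∀ L ∈ C, ∀ u : FreeMonoid A,
    {w : FreeMonoid A | u * w ∈ L} ∈ C ∧ {w : FreeMonoid A | w * u ∈ L} ∈ C

/-- A language is regular if it is a preimage of a subset under a monoid morphism
into a finite monoid. -/
def IsRegularLang (L : Lang A) : Prop :=
  ∃ (M : Type) (_ : Monoid M) (_ : Finite M) (φ : FreeMonoid A →* M) (F : Set M),
    L = φ ⁻¹' F

/-- A positive prevariety: a quotient-closed lattice of regular languages. -/
def IsPositivePrevariety (C : LangClass A) : Prop :=
  IsLatticeClass C ∧ QuotientClosed C ∧ ∀ L ∈ C, IsRegularLang L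

/-- A prevariety: a quotient-closed Boolean algebra of regular languages. -/
def IsPrevariety (C : LangClass A) : Prop :=
  IsBooleanAlgebraClass C ∧ QuotientClosed C ∧ ∀ L ∈ C, IsRegularLang L

/-- The marked concatenation `KaL = {uav : u ∈ K, v ∈ L}`. -/
def MarkedCat (K : Lang A) (a : A) (L : Lang A) : Lang A :=
  {w | ∃ u ∈ K, ∃ v ∈ L, w = u * FreeMonoid.of a * v}

/-- A marked concatenation `KaL` is unambiguous if every word of `KaL` has a
unique factorization `uav` with `u ∈ K` and `v ∈ L`. -/
def Unambiguous (K : Lang A) (a : A) (L : Lang A) : Prop :=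
  ∀ u u' v v' : FreeMonoid A, u ∈ K → u' ∈ K → v ∈ L → v' ∈ L →
    u * FreeMonoid.of a * v = u' * FreeMonoid.of a * v' → u = u' ∧ v = v'

/-- The marked concatenation `KaL` is left deterministic: `K ∩ KaA* = ∅`. -/
def LeftDeterministic (K : Lang A) (a : A) (_L : Lang A) : Prop :=
  K ∩ MarkedCat K a Set.univ = ∅

/-- The marked concatenation `KaL` is right deterministic: `L ∩ A*aL = ∅`. -/
def RightDeterministic (_K : Lang A) (a : A) (L : Lang A) : Prop :=
  L ∩ MarkedCat Set.univ a L = ∅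

/-- Polynomial closure: the least class containing `C` and closed under binary
union and marked concatenation. -/
inductive Pol (C : LangClass A) : Lang A → Prop
  | base {L : Lang A} : L ∈ C → Pol C L
  | union {K L : Lang A} : Pol C K → Pol C L → Pol C (K ∪ L)
  | mcat {K L : Lang A} (a : A) : Pol C K → Pol C L → Pol C (MarkedCat K a L)

/-- `coPol C`: the class of complements of languages in `Pol C`. -/
def coPol (C : LangClass A) : LangClass A := {L | ∃ K : Lang A, Pol C K ∧ L = Kᶜ}

/-- `BPol C`: the least Boolean algebra of languages containing `Pol C`. -/
inductive BPol (C : LangClass A) : Lang A → Prop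
  | base {L : Lang A} : Pol C L → BPol C L
  | empty : BPol C ∅
  | univ : BPol C Set.univ
  | union {K L : Lang A} : BPol C K → BPol C L → BPol C (K ∪ L)
  | inter {K L : Lang A} : BPol C K → BPol C L → BPol C (K ∩ L)
  | compl {L : Lang A} : BPol C L → BPol C Lᶜ

/-- Unambiguous polynomial closure: the least class containing `C` and closed
under disjoint union and unambiguous marked concatenation. -/
inductive UPol (C : LangClass A) : Lang A → Prop
  | base {L : Lang A} : L ∈ C → UPol C L
  | disjUnion {K L : Lang A} : UPol C K → UPol C L → K ∩ L = ∅ → UPol C (K ∪ L)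
  | mcat {K L : Lang A} (a : A) : UPol C K → UPol C L → Unambiguous K a L →
      UPol C (MarkedCat K a L)

/-- Alternated polynomial closure: the least class containing `C` and closed under
disjoint union and left- and right-deterministic marked concatenation. -/
inductive APol (C : LangClass A) : Lang A → Prop
  | base {L : Lang A} : L ∈ C → APol C L
  | disjUnion {K L : Lang A} : APol C K → APol C L → K ∩ L = ∅ → APol C (K ∪ L)
  | leftCat {K L : Lang A} (a : A) : APol C K → APol C L → LeftDeterministic K a L →
      APol C (MarkedCat K a L)
  | rightCat {K L : Lang A} (a : A) : APol C K → APol C L → RightDeterministic K a L →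
      APol C (MarkedCat K a L)

/-- `KaL` is left `C`-deterministic: there are `K', L' ∈ C` with `K ⊆ K'`, `L ⊆ L'`
and `K'aL'` left deterministic. -/
def LeftCDeterministic (C : LangClass A) (K : Lang A) (a : A) (L : Lang A) : Prop :=
  ∃ K' ∈ C, ∃ L' ∈ C, K ⊆ K' ∧ L ⊆ L' ∧ LeftDeterministic K' a L'

/-- `KaL` is right `C`-deterministic: there are `K', L' ∈ C` with `K ⊆ K'`, `L ⊆ L'`
and `K'aL'` right deterministic. -/
def RightCDeterministic (C : LangClass A) (K : Lang A) (a : A) (L : Lang A) : Prop :=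
  ∃ K' ∈ C, ∃ L' ∈ C, K ⊆ K' ∧ L ⊆ L' ∧ RightDeterministic K' a L'

/-- Weak alternated polynomial closure: the least class containing `C` and closed under
disjoint union and left- and right-`C`-deterministic marked concatenation. -/
inductive WAPol (C : LangClass A) : Lang A → Prop
  | base {L : Lang A} : L ∈ C → WAPol C L
  | disjUnion {K L : Lang A} : WAPol C K → WAPol C L → K ∩ L = ∅ → WAPol C (K ∪ L)
  | leftCat {K L : Lang A} (a : A) : WAPol C K → WAPol C L →
      LeftCDeterministic C K a L → WAPol C (MarkedCat K a L)
  | rightCat {K L : Lang A} (a : A) : WAPol C K → WAPol C L →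
      RightCDeterministic C K a L → WAPol C (MarkedCat K a L)

/-- `K` separates `L₁` from `L₂`. -/
def Separates (K L₁ L₂ : Lang A) : Prop := L₁ ⊆ K ∧ K ∩ L₂ = ∅

/-- `L₁` is `C`-separable from `L₂`. -/
def Separable (C : LangClass A) (L₁ L₂ : Lang A) : Prop := ∃ K ∈ C, Separates K L₁ L₂

/-- `(s, t)` is a `C`-pair for `φ`: `φ⁻¹(s)` is not `C`-separable from `φ⁻¹(t)`. -/
def CPair (C : LangClass A) {M : Type} [Monoid M] (φ : FreeMonoid A →* M)
    (s t : M) : Prop :=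
  ¬ Separable C (φ ⁻¹' {s}) (φ ⁻¹' {t})

/-- The canonical `C`-preorder on `M` associated with `φ`. -/
def CPreorder (C : LangClass A) {M : Type} [Monoid M] (φ : FreeMonoid A →* M)
    (s t : M) : Prop :=
  ∀ F : Set M, φ ⁻¹' F ∈ C → s ∈ F → t ∈ F

/-- The canonical `C`-equivalence on `M` associated with `φ`. -/
def CEquiv (C : LangClass A) {M : Type} [Monoid M] (φ : FreeMonoid A →* M)
    (s t : M) : Prop :=
  ∀ F : Set M, φ ⁻¹' F ∈ C → (s ∈ F ↔ t ∈ F)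

/-- A `C`-morphism: a surjective morphism all of whose recognized languages are in `C`. -/
def IsCMorphism (C : LangClass A) {N : Type} [Monoid N] (η : FreeMonoid A →* N) : Prop :=
  Function.Surjective η ∧ ∀ F : Set N, η ⁻¹' F ∈ C

/-- `e` is the idempotent power `s^ω` of `s`: an idempotent of the form `s^n`, `n ≥ 1`
(in a finite monoid such an element exists and is unique). -/
def IsIdempotentPower {M : Type} [Monoid M] (s e : M) : Prop :=
  IsIdempotentElem e ∧ ∃ n : ℕ, 1 ≤ n ∧ e = s ^ n

/-- The `C`-kernel of `φ`: the elements `s` such that `{ε}` is not `C`-separable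
from `φ⁻¹(s)`. -/
def gKernel (C : LangClass A) {M : Type} [Monoid M] (φ : FreeMonoid A →* M) : Set M :=
  {s | ¬ Separable C ({1} : Lang A) (φ ⁻¹' {s})}

/-- The strict `C`-kernel of `φ`: the intersection of the `C`-kernel with `φ(A⁺)`. -/
def strictGKernel (C : LangClass A) {M : Type} [Monoid M]
    (φ : FreeMonoid A →* M) : Set M :=
  gKernel C φ ∩ φ '' {w : FreeMonoid A | w ≠ 1}

/-- A group language: one recognized by a morphism into a finite group. -/
def IsGroupLanguage (L : Lang A) : Prop :=
  ∃ (G : Type) (_ : Group G) (_ : Finite G) (φ : FreeMonoid A →* G) (F : Set G),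
    L = φ ⁻¹' F

/-- A prevariety of group languages. -/
def IsGroupPrevariety (G : LangClass A) : Prop :=
  IsPrevariety G ∧ ∀ L ∈ G, IsGroupLanguage L

/-- The well-suited extension `G⁺`: all languages `L ∩ A⁺` and `L ∪ {ε}` for `L ∈ G`. -/
def wellSuited (G : LangClass A) : LangClass A :=
  {L | ∃ K ∈ G, L = K ∩ {w : FreeMonoid A | w ≠ 1} ∨ L = K ∪ ({1} : Lang A)}

/-- `le` is a partial order on the monoid `N` compatible with multiplication. -/
def IsCompatiblePartialOrder {N : Type} [Monoid N] (le : N → N → Prop) : Prop :=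
  (∀ x, le x x) ∧ (∀ x y z, le x y → le y z → le x z) ∧
    (∀ x y, le x y → le y x → x = y) ∧
    (∀ x x' y y', le x y → le x' y' → le (x * x') (y * y'))

/-- `F` is upward closed for the relation `le`. -/
def UpClosed {N : Type} (le : N → N → Prop) (F : Set N) : Prop :=
  ∀ s ∈ F, ∀ t, le s t → t ∈ F

/-- An ordered `C`-morphism: a surjective morphism onto a finite ordered monoid such
that preimages of upward closed sets are in `C`. -/
def IsOrderedCMorphism (C : LangClass A) {N : Type} [Monoid N]
    (η : FreeMonoid A →* N) (le : N → N → Prop) : Prop :=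
  Function.Surjective η ∧ IsCompatiblePartialOrder le ∧
    ∀ F : Set N, UpClosed le F → η ⁻¹' F ∈ C

/-- The syntactic preorder of `L`: `u ≼_L v` iff `xuy ∈ L → xvy ∈ L` for all `x, y`. -/
def SynPre (L : Lang A) (u v : FreeMonoid A) : Prop :=
  ∀ x y : FreeMonoid A, x * u * y ∈ L → x * v * y ∈ L

/-- `φ` is (a copy of) the syntactic morphism of `L`: it is surjective and identifies
exactly the words that are syntactically congruent for `L`. -/
def IsSyntacticMorphism (L : Lang A) {M : Type} [Monoid M]
    (φ : FreeMonoid A →* M) : Prop :=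
  Function.Surjective φ ∧
    ∀ u v : FreeMonoid A, φ u = φ v ↔ ∀ x y : FreeMonoid A, (x * u * y ∈ L ↔ x * v * y ∈ L)

/-- `le` is (a copy of) the syntactic order of `L` on the target of `φ`. -/
def IsSyntacticOrder (L : Lang A) {M : Type} [Monoid M] (φ : FreeMonoid A →* M)
    (le : M → M → Prop) : Prop :=
  ∀ u v : FreeMonoid A, le (φ u) (φ v) ↔ SynPre L u v

/-! ### Finite monoids -/

theorem exists_idempotent_pow {M : Type} [Monoid M] [Finite M] (a : M) :
    ∃ n : ℕ, a ^ (n + 1) * a ^ (n + 1) = a ^ (n + 1) := by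
  obtain ⟨i, j, hij, h⟩ := Finite.exists_ne_map_eq_of_infinite (fun n : ℕ => a ^ n)
  wlog hlt : i < j generalizing i j
  · exact this j i hij.symm h.symm (by omega)
  obtain ⟨p, rfl⟩ := Nat.exists_eq_add_of_lt hlt
  have step : ∀ m, i ≤ m → a ^ (m + (p + 1)) = a ^ m := by
    intro m hm
    obtain ⟨k, rfl⟩ := Nat.exists_eq_add_of_le hm
    have h' : a ^ i = a ^ (i + (p + 1)) := by simpa [add_assoc] using h
    rw [show i + k + (p + 1) = (i + (p + 1)) + k by ring, pow_add, ← h', ← pow_add]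
  have steps : ∀ k m, i ≤ m → a ^ (m + k * (p + 1)) = a ^ m := by
    intro k
    induction k with
    | zero => simp
    | succ k ih =>
      intro m hm
      rw [show m + (k + 1) * (p + 1) = (m + k * (p + 1)) + (p + 1) by ring,
        step _ (by omega), ih m hm]
  refine ⟨(i + 1) * (p + 1) - 1, ?_⟩
  have hpos : (i + 1) * (p + 1) - 1 + 1 = (i + 1) * (p + 1) :=
    Nat.sub_add_cancel (Nat.mul_pos (Nat.succ_pos _) (Nat.succ_pos _))
  rw [hpos, ← pow_add]
  exact steps _ _ (by nlinarith)

/-- The Green preorder `≤` for `J`: `x` lies in the two-sided ideal generated by `y`. -/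
def JLe {N : Type} [Monoid N] (x y : N) : Prop := ∃ c d, x = c * y * d

theorem JLe.refl {N : Type} [Monoid N] (x : N) : JLe x x := ⟨1, 1, by simp⟩

theorem JLe.trans {N : Type} [Monoid N] {x y z : N} (h : JLe x y) (h' : JLe y z) :
    JLe x z := by
  obtain ⟨a, b, rfl⟩ := h
  obtain ⟨c, d, rfl⟩ := h'
  exact ⟨a * c, d * b, by simp only [mul_assoc]⟩

theorem JLe.mul_right {N : Type} [Monoid N] {x y : N} (h : JLe x y) (z : N) :
    JLe (x * z) y :=
  JLe.trans ⟨1, z, by simp⟩ h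

theorem JLe.mul_left {N : Type} [Monoid N] {x y : N} (h : JLe x y) (z : N) :
    JLe (z * x) y :=
  JLe.trans ⟨z, 1, by simp⟩ h

theorem exists_mul_eq_of_jLe_mul {N : Type} [Monoid N] [Finite N] {a b : N}
    (h : JLe a (a * b)) : ∃ m, a * b * m = a := by
  obtain ⟨c, d, h⟩ := h
  have key : ∀ n : ℕ, a = c ^ n * a * (b * d) ^ n := by
    intro n
    induction n with
    | zero => simp
    | succ n ih =>
      calc a = c ^ n * a * (b * d) ^ n := ih
        _ = c ^ n * (c * (a * b) * d) * (b * d) ^ n := by rw [← h]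
        _ = _ := by rw [pow_succ c, pow_succ' (b * d)]; simp only [mul_assoc]
  obtain ⟨n, hn⟩ := exists_idempotent_pow (b * d)
  refine ⟨d * (b * d) ^ n, ?_⟩
  calc a * b * (d * (b * d) ^ n) = a * (b * d) ^ (n + 1) := by
        rw [pow_succ']; simp only [mul_assoc]
    _ = c ^ (n + 1) * a * (b * d) ^ (n + 1) * (b * d) ^ (n + 1) := by rw [← key]
    _ = a := by rw [mul_assoc _ (_ ^ _) (_ ^ _), hn, ← key]

theorem exists_mul_eq_of_jLe_mul' {N : Type} [Monoid N] [Finite N] {a b : N}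
    (h : JLe a (b * a)) : ∃ n, n * (b * a) = a := by
  obtain ⟨c, d, h⟩ := h
  have key : ∀ n : ℕ, a = (c * b) ^ n * a * d ^ n := by
    intro n
    induction n with
    | zero => simp
    | succ n ih =>
      calc a = (c * b) ^ n * a * d ^ n := ih
        _ = (c * b) ^ n * (c * (b * a) * d) * d ^ n := by rw [← h]
        _ = _ := by rw [pow_succ (c * b), pow_succ' d]; simp only [mul_assoc]
  obtain ⟨n, hn⟩ := exists_idempotent_pow (c * b)
  refine ⟨(c * b) ^ n * c, ?_⟩
  calc (c * b) ^ n * c * (b * a) = (c * b) ^ (n + 1) * a := by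
        rw [pow_succ]; simp only [mul_assoc]
    _ = (c * b) ^ (n + 1) * ((c * b) ^ (n + 1) * a * d ^ (n + 1)) := by rw [← key]
    _ = a := by rw [← mul_assoc, ← mul_assoc, hn, ← key]

/-- The fibres of `β` over idempotents are locally trivial semigroups. -/
def LocallyTrivial {M N : Type} [Monoid M] [Monoid N] (β : M →* N) : Prop :=
  ∀ e t : M, e * e = e → β t = β e → e * t * e = e

theorem LocallyTrivial.sandwich {M N : Type} [Monoid M] [Monoid N] {β : M →* N}
    (hE : LocallyTrivial β) (hβ : Function.Surjective β) {e f p p' : M} {m n : N}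
    (he : e * e = e) (hf : f * f = f) (hp : β p = β p')
    (hm : β e * β p * β f * m = β e) (hn : n * (β e * β p * β f) = β f) :
    e * p * f = e * p' * f := by
  obtain ⟨m, rfl⟩ := hβ m
  obtain ⟨n, rfl⟩ := hβ n
  have hne : β f * (β n * β e) * β p * β f = β f := by
    calc β f * (β n * β e) * β p * β f = β f * (β n * (β e * β p * β f)) := by
          simp only [mul_assoc]
      _ = β f := by rw [hn, ← map_mul, hf]
  have hen : β e * (β p * β f * β n) * β e = β e := by
    calc β e * (β p * β f * β n) * β e
        = β e * (β p * β f * β n) * (β e * β p * β f * β m) := by rw [hm]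
      _ = β e * β p * β f * (β n * (β e * β p * β f)) * β m := by simp only [mul_assoc]
      _ = β e * β p * (β f * β f) * β m := by rw [hn]; simp only [mul_assoc]
      _ = β e := by rw [← map_mul β f, hf, hm]
  have h1 : e * (p * f * n) * e = e := by
    have := hE e (e * (p * f * n) * e) he (by simpa only [map_mul] using hen)
    calc e * (p * f * n) * e = (e * e) * (p * f * n) * (e * e) := by rw [he]
      _ = e * (e * (p * f * n) * e) * e := by simp only [mul_assoc]
      _ = e := this
  have h2 : f * (n * e) * p' * f = f := by
    have := hE f (f * (n * e) * p' * f) hf (by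
      simp only [map_mul, ← hp]; simpa only [map_mul] using hne)
    calc f * (n * e) * p' * f = (f * f) * (n * e) * p' * (f * f) := by rw [hf]
      _ = f * (f * (n * e) * p' * f) * f := by simp only [mul_assoc]
      _ = f := this
  calc e * p * f = e * p * (f * (n * e) * p' * f) := by rw [h2]
    _ = (e * (p * f * n) * e) * p' * f := by simp only [mul_assoc]
    _ = e * p' * f := by rw [h1]

theorem LocallyTrivial.mul_eq_mul {M N : Type} [Monoid M] [Monoid N] [Finite N] {β : M →* N}
    (hE : LocallyTrivial β) (hβ : Function.Surjective β) {e f p p' q r : M} {x : N}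
    (he : e * e = e) (hf : f * f = f) (hqe : q * e = q) (hfr : f * r = r)
    (hex : JLe (β e) x) (hfx : JLe (β f) x) (hp : β p = β p')
    (hx : β q * β p * β r = x) : q * p * r = q * p' * r := by
  have key : ∀ p, q * p * r = q * (e * p * f) * r := fun p =>
    calc q * p * r = (q * e) * p * (f * r) := by rw [hqe, hfr]
      _ = _ := by simp only [mul_assoc]
  have hxP : JLe x (β e * β p * β f) :=
    ⟨β q, β r, by rw [← hx]; simpa only [map_mul] using congrArg β (key p)⟩
  obtain ⟨m, hm⟩ := exists_mul_eq_of_jLe_mul (a := β e) (b := β p * β f)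
    (by rw [← mul_assoc]; exact hex.trans hxP)
  obtain ⟨n, hn⟩ := exists_mul_eq_of_jLe_mul' (a := β f) (b := β e * β p) (hfx.trans hxP)
  rw [key p, key p', hE.sandwich hβ he hf hp (by rwa [mul_assoc (β e)]) hn]

/-! ### Factorizations of words -/

theorem marked_eq_mul {p q x y : FreeMonoid A} {a : A}
    (h : p * FreeMonoid.of a * q = x * y) :
    (∃ r, x = p * FreeMonoid.of a * r ∧ q = r * y) ∨
      (∃ r, y = r * FreeMonoid.of a * q ∧ p = x * r) := by
  have h' : p.toList ++ a :: q.toList = x.toList ++ y.toList := by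
    simpa using congrArg FreeMonoid.toList h
  rcases List.append_eq_append_iff.1 h' with ⟨s, hs, hs'⟩ | ⟨s, hs, hs'⟩
  · cases s with
    | nil =>
      refine .inr ⟨1, FreeMonoid.toList.injective ?_, FreeMonoid.toList.injective ?_⟩
      · simpa using hs'.symm
      · simpa using hs.symm
    | cons b s =>
      simp only [List.cons_append, List.cons.injEq] at hs'
      obtain ⟨rfl, hs'⟩ := hs'
      refine .inl ⟨FreeMonoid.ofList s, FreeMonoid.toList.injective ?_,
        FreeMonoid.toList.injective ?_⟩
      · simpa using hs
      · simpa using hs'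
  · refine .inr ⟨FreeMonoid.ofList s, FreeMonoid.toList.injective ?_,
      FreeMonoid.toList.injective ?_⟩
    · simpa using hs'
    · simpa using hs

theorem marked_eq_marked {u u' v v' : FreeMonoid A} {a a' : A}
    (h : u * FreeMonoid.of a * v = u' * FreeMonoid.of a' * v') :
    (u = u' ∧ a = a' ∧ v = v') ∨
      (∃ r, u' = u * FreeMonoid.of a * r ∧ v = r * FreeMonoid.of a' * v') ∨
      (∃ r, u = u' * FreeMonoid.of a' * r ∧ v' = r * FreeMonoid.of a * v) := by
  rcases marked_eq_mul (h.trans (mul_assoc _ _ _)) with ⟨r, hr, hr'⟩ | ⟨r, hr, hr'⟩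
  · exact .inr (.inl ⟨r, hr, by rw [hr', mul_assoc]⟩)
  · cases r using FreeMonoid.casesOn with
    | one =>
      have hl : a' :: v'.toList = a :: v.toList := by
        simpa using congrArg FreeMonoid.toList hr
      obtain ⟨rfl, hv⟩ := List.cons.inj hl
      exact .inl ⟨by simpa using hr', rfl, FreeMonoid.toList.injective hv.symm⟩
    | of_mul b r =>
      have hl : a' :: v'.toList = b :: (r * FreeMonoid.of a * v).toList := by
        simpa using congrArg FreeMonoid.toList hr
      obtain ⟨rfl, hv⟩ := List.cons.inj hl
      exact .inr (.inr ⟨r, by rw [hr', mul_assoc], FreeMonoid.toList.injective hv⟩)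

/-- If `P` holds of `w` but not of the empty word, some prefix of `w` is minimal for `P`. -/
theorem exists_minimal_prefix (P : FreeMonoid A → Prop) (h1 : ¬ P 1) (w : FreeMonoid A)
    (hw : P w) : ∃ u a v, w = u * FreeMonoid.of a * v ∧ ¬ P u ∧ P (u * FreeMonoid.of a) := by
  suffices H : ∀ w x : FreeMonoid A, ¬ P x → P (x * w) →
      ∃ u a v, x * w = u * FreeMonoid.of a * v ∧ ¬ P u ∧ P (u * FreeMonoid.of a) by
    simpa using H w 1 h1 (by simpa using hw)
  intro w
  induction w using FreeMonoid.inductionOn' with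
  | one => intro x hx hx'; exact absurd (by simpa using hx') hx
  | of_mul b w ih =>
    intro x hx hxw
    by_cases hb : P (x * FreeMonoid.of b)
    · exact ⟨x, b, w, by rw [mul_assoc], hx, hb⟩
    · simpa only [mul_assoc] using ih _ hb (by rwa [mul_assoc])

/-- If `P` holds of `w` but not of the empty word, some suffix of `w` is minimal for `P`. -/
theorem exists_minimal_suffix (P : FreeMonoid A → Prop) (h1 : ¬ P 1) (w : FreeMonoid A)
    (hw : P w) : ∃ u a v, w = u * FreeMonoid.of a * v ∧ ¬ P v ∧ P (FreeMonoid.of a * v) := by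
  suffices H : ∀ w x : FreeMonoid A, P (w * x) → P x ∨
      ∃ u a v, w * x = u * FreeMonoid.of a * v ∧ ¬ P v ∧ P (FreeMonoid.of a * v) by
    simpa [h1] using H w 1 (by simpa using hw)
  intro w
  induction w using FreeMonoid.inductionOn' with
  | one => intro x hx; exact .inl (by simpa using hx)
  | of_mul b w ih =>
    intro x hx
    by_cases hb : P (w * x)
    · rcases ih x hb with h | ⟨u, a, v, h, hv, hav⟩
      · exact .inl h
      · exact .inr ⟨FreeMonoid.of b * u, a, v, by simp only [mul_assoc] at h ⊢; rw [h], hv, hav⟩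
    · exact .inr ⟨1, b, w * x, by simp only [mul_assoc, one_mul], hb, by rwa [← mul_assoc]⟩

/-! ### Unambiguous polynomial closure -/

theorem UPol.biUnion {C : LangClass A} (h0 : ∅ ∈ C) {ι : Type} (s : Finset ι)
    {H : ι → Lang A} (hH : ∀ i, UPol C (H i))
    (hd : ∀ i j w, w ∈ H i → w ∈ H j → i = j) : UPol C (⋃ i ∈ s, H i) := by
  classical
  induction s using Finset.induction_on with
  | empty => simpa using UPol.base h0
  | insert i s hi ih =>
    rw [Finset.set_biUnion_insert]
    refine UPol.disjUnion (hH i) ih (Set.eq_empty_of_forall_notMem ?_)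
    rintro w ⟨hw, hw'⟩
    obtain ⟨j, hj, hw'⟩ := Set.mem_iUnion₂.1 hw'
    exact hi (hd i j w hw hw' ▸ hj)

theorem UPol.iUnion {C : LangClass A} (h0 : ∅ ∈ C) {ι : Type} [Finite ι]
    {H : ι → Lang A} (hH : ∀ i, UPol C (H i))
    (hd : ∀ i j w, w ∈ H i → w ∈ H j → i = j) : UPol C (⋃ i, H i) := by
  have := Fintype.ofFinite ι
  simpa using UPol.biUnion h0 Finset.univ hH hd

theorem UPol.pol {C : LangClass A} {L : Lang A} (h : UPol C L) : Pol C L := by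
  induction h with
  | base h => exact .base h
  | disjUnion _ _ _ hK hL => exact .union hK hL
  | mcat a _ _ _ hK hL => exact .mcat a hK hL

/-- Words with `β ∘ α`-value `z` whose `α`-value becomes `s` when placed in the context `(q, r)`. -/
def ctxLang {M N : Type} [Monoid M] [Monoid N] (α : FreeMonoid A →* M) (β : M →* N)
    (q r : M) (z : N) (s : M) : Lang A :=
  {w | β (α w) = z ∧ q * α w * r = s}

section Synthesis

variable {M N : Type} [Monoid M] [Monoid N] {α : FreeMonoid A →* M} {β : M →* N} {C : LangClass A}

theorem upol_ctxLang_of_fibres [Finite M] (h0 : ∅ ∈ C) {z : N}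
    (h : ∀ g, β g = z → UPol C (α ⁻¹' {g})) (q r s : M) : UPol C (ctxLang α β q r z s) := by
  have : ctxLang α β q r z s = ⋃ g : {g : M // β g = z ∧ q * g * r = s}, α ⁻¹' {g.1} := by
    ext w
    simp [ctxLang]
  rw [this]
  refine UPol.iUnion h0 (fun g => h _ g.2.1) ?_
  rintro ⟨g, _⟩ ⟨g', _⟩ w (rfl : α w = g) (rfl : α w = g')
  rfl

theorem upol_ctxLang_peel_left [Finite A] [Finite M] [Finite N] (h0 : ∅ ∈ C) {x z : N} {q r : M}
    (h1 : ¬ JLe 1 x) (hz : JLe z x)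
    (hfib : ∀ g a z', β g * β (α (FreeMonoid.of a)) * z' = z → ¬ JLe (β g) x →
      JLe (β g * β (α (FreeMonoid.of a))) x → UPol C (α ⁻¹' {g}))
    (hrest : ∀ g a z', β g * β (α (FreeMonoid.of a)) * z' = z →
      JLe (β g * β (α (FreeMonoid.of a))) x → ∀ s,
        UPol C (ctxLang α β (q * (g * α (FreeMonoid.of a))) r z' s))
    (s : M) : UPol C (ctxLang α β q r z s) := by
  have huniq : ∀ {u u' v v' : FreeMonoid A} {a a' : A},
      ¬ JLe (β (α u)) x → ¬ JLe (β (α u')) x →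
      JLe (β (α u) * β (α (FreeMonoid.of a))) x → JLe (β (α u') * β (α (FreeMonoid.of a'))) x →
      u * FreeMonoid.of a * v = u' * FreeMonoid.of a' * v' → u = u' ∧ a = a' ∧ v = v' := by
    intro u u' v v' a a' hu hu' hua hua' h
    rcases marked_eq_marked h with h | ⟨t, rfl, -⟩ | ⟨t, rfl, -⟩
    · exact h
    · exact absurd (by simpa only [map_mul] using hua.mul_right (β (α t))) hu'
    · exact absurd (by simpa only [map_mul] using hua'.mul_right (β (α t))) hu
  have hunion : ctxLang α β q r z s =
      ⋃ i : {i : M × A × N // β i.1 * β (α (FreeMonoid.of i.2.1)) * i.2.2 = z ∧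
          ¬ JLe (β i.1) x ∧ JLe (β i.1 * β (α (FreeMonoid.of i.2.1))) x},
        MarkedCat (α ⁻¹' {i.1.1}) i.1.2.1
          (ctxLang α β (q * (i.1.1 * α (FreeMonoid.of i.1.2.1))) r i.1.2.2 s) := by
    ext w
    simp only [Set.mem_iUnion]
    constructor
    · rintro ⟨hw, hs⟩
      obtain ⟨u, a, v, rfl, hu, hua⟩ := exists_minimal_prefix (fun w => JLe (β (α w)) x)
        (by simpa using h1) w (by rwa [hw])
      simp only [map_mul] at hw hs hua
      exact ⟨⟨⟨α u, a, β (α v)⟩, hw, hu, hua⟩, u, rfl, v,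
        ⟨rfl, by simpa only [mul_assoc] using hs⟩, rfl⟩
    · rintro ⟨⟨⟨g, a, z'⟩, hz', hu, hua⟩, u, rfl, v, ⟨rfl, hs⟩, rfl⟩
      exact ⟨by simpa only [map_mul] using hz', by simpa only [map_mul, mul_assoc] using hs⟩
  rw [hunion]
  refine UPol.iUnion h0 ?_ ?_
  · rintro ⟨⟨g, a, z'⟩, hz', hg, hga⟩
    refine UPol.mcat a (hfib g a z' hz' hg hga) (hrest g a z' hz' hga s) ?_
    rintro u u' v v' (rfl : α u = g) (hu' : α u' = α u) - - h
    have := huniq hg (by rwa [hu']) hga (by rwa [hu']) h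
    exact ⟨this.1, this.2.2⟩
  · rintro ⟨⟨g, a, z'⟩, hz', hg, hga⟩ ⟨⟨k, b, y'⟩, hy', hk, hkb⟩ w
      ⟨u, rfl, v, ⟨rfl, -⟩, rfl⟩ ⟨u', rfl, v', ⟨rfl, -⟩, h⟩
    obtain ⟨rfl, rfl, rfl⟩ := huniq hg hk hga hkb h
    rfl

theorem upol_ctxLang_peel_right [Finite A] [Finite M] [Finite N] (h0 : ∅ ∈ C) {x z : N} {q r : M}
    (h1 : ¬ JLe 1 x) (hz : JLe z x)
    (hfib : ∀ z' a g, z' * (β (α (FreeMonoid.of a)) * β g) = z → ¬ JLe (β g) x →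
      JLe (β (α (FreeMonoid.of a)) * β g) x → UPol C (α ⁻¹' {g}))
    (hrest : ∀ z' a g, z' * (β (α (FreeMonoid.of a)) * β g) = z →
      JLe (β (α (FreeMonoid.of a)) * β g) x → ∀ s,
        UPol C (ctxLang α β q (α (FreeMonoid.of a) * g * r) z' s))
    (s : M) : UPol C (ctxLang α β q r z s) := by
  have huniq : ∀ {u u' v v' : FreeMonoid A} {a a' : A},
      ¬ JLe (β (α v)) x → ¬ JLe (β (α v')) x →
      JLe (β (α (FreeMonoid.of a)) * β (α v)) x → JLe (β (α (FreeMonoid.of a')) * β (α v')) x →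
      u * FreeMonoid.of a * v = u' * FreeMonoid.of a' * v' → u = u' ∧ a = a' ∧ v = v' := by
    intro u u' v v' a a' hv hv' hav hav' h
    rcases marked_eq_marked h with h | ⟨t, -, rfl⟩ | ⟨t, -, rfl⟩
    · exact h
    · exact absurd (by simpa only [map_mul, mul_assoc] using hav'.mul_left (β (α t))) hv
    · exact absurd (by simpa only [map_mul, mul_assoc] using hav.mul_left (β (α t))) hv'
  have hunion : ctxLang α β q r z s =
      ⋃ i : {i : N × A × M // i.1 * (β (α (FreeMonoid.of i.2.1)) * β i.2.2) = z ∧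
          ¬ JLe (β i.2.2) x ∧ JLe (β (α (FreeMonoid.of i.2.1)) * β i.2.2) x},
        MarkedCat (ctxLang α β q (α (FreeMonoid.of i.1.2.1) * i.1.2.2 * r) i.1.1 s) i.1.2.1
          (α ⁻¹' {i.1.2.2}) := by
    ext w
    simp only [Set.mem_iUnion]
    constructor
    · rintro ⟨hw, hs⟩
      obtain ⟨u, a, v, rfl, hv, hav⟩ := exists_minimal_suffix (fun w => JLe (β (α w)) x)
        (by simpa using h1) w (by rwa [hw])
      simp only [map_mul] at hw hs hav
      exact ⟨⟨⟨β (α u), a, α v⟩, by simpa only [mul_assoc] using hw, hv, hav⟩, u,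
        ⟨rfl, by simpa only [mul_assoc] using hs⟩, v, rfl, rfl⟩
    · rintro ⟨⟨⟨z', a, g⟩, hz', hv, hav⟩, u, ⟨rfl, hs⟩, v, rfl, rfl⟩
      exact ⟨by simpa only [map_mul, mul_assoc] using hz',
        by simpa only [map_mul, mul_assoc] using hs⟩
  rw [hunion]
  refine UPol.iUnion h0 ?_ ?_
  · rintro ⟨⟨z', a, g⟩, hz', hg, hag⟩
    refine UPol.mcat a (hrest z' a g hz' hag s) (hfib z' a g hz' hg hag) ?_
    rintro u u' v v' - - (rfl : α v = g) (hv' : α v' = α v) h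
    have := huniq hg (by rwa [hv']) hag (by rwa [hv']) h
    exact ⟨this.1, this.2.2⟩
  · rintro ⟨⟨z', a, g⟩, hz', hg, hag⟩ ⟨⟨y', b, k⟩, hy', hk, hbk⟩ w
      ⟨u, ⟨rfl, -⟩, v, rfl, rfl⟩ ⟨u', ⟨rfl, -⟩, v', rfl, h⟩
    obtain ⟨rfl, rfl, rfl⟩ := huniq hg hk hag hbk h
    rfl

theorem upol_ctxLang_of_stable [Finite N] (hCL : IsLatticeClass C) (hβ : Function.Surjective β)
    (hE : LocallyTrivial β) (hC : ∀ z, {w | β (α w) = z} ∈ C) {x z : N} {q r e f : M}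
    (hx : β q * z * β r = x) (he : e * e = e) (hqe : q * e = q) (hex : JLe (β e) x)
    (hf : f * f = f) (hfr : f * r = r) (hfx : JLe (β f) x) (s : M) :
    UPol C (ctxLang α β q r z s) := by
  by_cases hne : ∃ w, w ∈ ctxLang α β q r z s
  · obtain ⟨w, rfl, rfl⟩ := hne
    have : ctxLang α β q r (β (α w)) (q * α w * r) = {w' | β (α w') = β (α w)} := by
      ext w'
      refine ⟨fun h => h.1, fun h => ⟨h, ?_⟩⟩
      exact (hE.mul_eq_mul hβ he hf hqe hfr hex hfx h.symm hx).symm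
    rw [this]
    exact .base (hC _)
  · rw [Set.eq_empty_of_forall_notMem (not_exists.1 hne)]
    exact .base hCL.1

theorem exists_stabilizer_right [Finite M] {x : N} {q g h : M} (hq : q * g * h = q)
    (hg : JLe (β g) x) : ∃ e, e * e = e ∧ q * e = q ∧ JLe (β e) x := by
  obtain ⟨n, hn⟩ := exists_idempotent_pow (g * h)
  refine ⟨_, hn, ?_, ?_⟩
  · have : ∀ k : ℕ, q * (g * h) ^ k = q := by
      intro k
      induction k with
      | zero => simp
      | succ k ih => rw [pow_succ', ← mul_assoc, ← mul_assoc, hq, ih]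
    exact this _
  · rw [pow_succ', map_mul, map_mul]
    exact (hg.mul_right _).mul_right _

theorem exists_stabilizer_left [Finite M] {x : N} {r g h : M} (hr : h * (g * r) = r)
    (hg : JLe (β g) x) : ∃ f, f * f = f ∧ f * r = r ∧ JLe (β f) x := by
  obtain ⟨n, hn⟩ := exists_idempotent_pow (h * g)
  refine ⟨_, hn, ?_, ?_⟩
  · have : ∀ k : ℕ, (h * g) ^ k * r = r := by
      intro k
      induction k with
      | zero => simp
      | succ k ih => rw [pow_succ, mul_assoc, mul_assoc h, hr, ih]
    exact this _
  · rw [pow_succ, map_mul, map_mul]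
    exact (hg.mul_left _).mul_left _

theorem range_ssubset_right {q k : M} (h : ¬ ∃ h, q * k * h = q) :
    Set.range (fun m => q * k * m) ⊂ Set.range (fun m => q * m) := by
  refine ⟨?_, fun H => h ?_⟩
  · rintro _ ⟨m, rfl⟩
    exact ⟨k * m, by simp only [mul_assoc]⟩
  · exact H ⟨1, by simp⟩

theorem range_ssubset_left {r k : M} (h : ¬ ∃ h, h * (k * r) = r) :
    Set.range (fun m => m * (k * r)) ⊂ Set.range (fun m => m * r) := by
  refine ⟨?_, fun H => h ?_⟩
  · rintro _ ⟨m, rfl⟩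
    exact ⟨m * k, by simp only [mul_assoc]⟩
  · exact H ⟨1, by simp⟩

theorem upol_ctxLang [Finite A] [Finite M] [Finite N] (hCL : IsLatticeClass C)
    (hβ : Function.Surjective β) (hE : LocallyTrivial β) (hC : ∀ z, {w | β (α w) = z} ∈ C) {x : N}
    (hfib : ∀ g, JLe x (β g) → ¬ JLe (β g) x → UPol C (α ⁻¹' {g})) (q r : M) (z : N)
    (hx : β q * z * β r = x) (s : M) : UPol C (ctxLang α β q r z s) := by
  induction hn : (Set.range (fun m => q * m)).ncard + (Set.range (fun m => m * r)).ncard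
    using Nat.strong_induction_on generalizing q r z s with
  | _ n ih =>
  subst hn
  by_cases hz : JLe z x
  swap
  · refine upol_ctxLang_of_fibres hCL.1 (fun g hg => hfib g ?_ (hg ▸ hz)) q r s
    exact ⟨β q, β r, by rw [hg, hx]⟩
  by_cases hq : ∃ e, e * e = e ∧ q * e = q ∧ JLe (β e) x
  · by_cases hr : ∃ f, f * f = f ∧ f * r = r ∧ JLe (β f) x
    · obtain ⟨e, he, hqe, hex⟩ := hq
      obtain ⟨f, hf, hfr, hfx⟩ := hr
      exact upol_ctxLang_of_stable hCL hβ hE hC hx he hqe hex hf hfr hfx s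
    · refine upol_ctxLang_peel_right hCL.1
        (fun h1 => hr ⟨1, by simp, by simp, by simpa using h1⟩) hz ?_ ?_ s
      · intro z' a g hz' hg _
        refine hfib g ⟨β q * z' * β (α (FreeMonoid.of a)), β r, ?_⟩ hg
        rw [← hx, ← hz']; simp only [mul_assoc]
      · intro z' a g hz' hag s
        refine ih _ ?_ q _ z' ?_ s rfl
        · refine Nat.add_lt_add_left (Set.ncard_lt_ncard (range_ssubset_left ?_) (Set.toFinite _)) _
          rintro ⟨h, hh⟩
          exact hr (exists_stabilizer_left hh (by rwa [map_mul]))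
        · rw [← hx, ← hz']; simp only [map_mul, mul_assoc]
  · refine upol_ctxLang_peel_left hCL.1
      (fun h1 => hq ⟨1, by simp, by simp, by simpa using h1⟩) hz ?_ ?_ s
    · intro g a z' hz' hg _
      refine hfib g ⟨β q, β (α (FreeMonoid.of a)) * z' * β r, ?_⟩ hg
      rw [← hx, ← hz']; simp only [mul_assoc]
    · intro g a z' hz' hga s
      refine ih _ ?_ _ r z' ?_ s rfl
      · refine Nat.add_lt_add_right (Set.ncard_lt_ncard (range_ssubset_right ?_) (Set.toFinite _)) _
        rintro ⟨h, hh⟩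
        exact hq (exists_stabilizer_right hh (by rwa [map_mul]))
      · rw [← hx, ← hz']; simp only [map_mul, mul_assoc]

theorem LocallyTrivial.upol_preimage_singleton [Finite A] [Finite M] [Finite N]
    (hE : LocallyTrivial β) (hβ : Function.Surjective β) (hCL : IsLatticeClass C)
    (hC : ∀ z, {w | β (α w) = z} ∈ C) (s : M) : UPol C (α ⁻¹' {s}) := by
  induction hn : {y | JLe (β s) y}.ncard using Nat.strong_induction_on generalizing s with
  | _ n ih =>
  subst hn
  have := upol_ctxLang hCL hβ hE hC (x := β s) (fun g hg hg' => ?_) 1 1 (β s) (by simp) s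
  · convert this using 1
    ext w
    simp only [ctxLang, one_mul, mul_one, Set.mem_preimage, Set.mem_singleton_iff,
      Set.mem_ofPred_eq]
    exact ⟨fun h => ⟨by rw [h], h⟩, fun h => h.2⟩
  · refine ih _ (Set.ncard_lt_ncard ⟨fun y hy => hg.trans hy, fun H => hg' ?_⟩ (Set.toFinite _)) g
      rfl
    exact H (JLe.refl (β s))

theorem LocallyTrivial.upol_preimage [Finite A] [Finite M] [Finite N]
    (hE : LocallyTrivial β) (hβ : Function.Surjective β) (hCL : IsLatticeClass C)
    (hC : ∀ z, {w | β (α w) = z} ∈ C) (F : Set M) : UPol C (α ⁻¹' F) := by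
  have : α ⁻¹' F = ⋃ s : F, α ⁻¹' {s.1} := by
    ext w
    simp
  rw [this]
  refine UPol.iUnion hCL.1 (fun s => hE.upol_preimage_singleton hβ hCL hC s.1) ?_
  rintro ⟨s, _⟩ ⟨s', _⟩ w (rfl : α w = s) (rfl : α w = s')
  rfl

end Synthesis

/-! ### Congruences -/

/-- The syntactic congruence of a language. -/
def synCon (L : Lang A) : Con (FreeMonoid A) where
  r u v := ∀ x y, x * u * y ∈ L ↔ x * v * y ∈ L
  iseqv := ⟨fun _ _ _ => Iff.rfl, fun h x y => (h x y).symm, fun h h' x y => (h x y).trans (h' x y)⟩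
  mul' := by
    intro u u' v v' h h' x y
    have h1 := h x (v * y)
    have h2 := h' (x * u') y
    simp only [mul_assoc] at h1 h2 ⊢
    exact h1.trans h2

theorem synCon_iff {L : Lang A} {u v : FreeMonoid A} :
    synCon L u v ↔ ∀ x y, x * u * y ∈ L ↔ x * v * y ∈ L := Iff.rfl

/-- `L` is a union of classes of `c`. -/
def Saturates (c : Con (FreeMonoid A)) (L : Lang A) : Prop :=
  ∀ {w w' : FreeMonoid A}, w ∈ L → (w : c.Quotient) = w' → w' ∈ L

theorem saturates_synCon (L : Lang A) : Saturates (synCon L) L := by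
  intro w w' hw h
  have := (synCon_iff.1 ((synCon L).eq.1 h)) 1 1
  simpa using this.1 (by simpa using hw)

theorem Saturates.mono {c c' : Con (FreeMonoid A)} {L : Lang A} (h : Saturates c L)
    (hc : c' ≤ c) : Saturates c' L :=
  fun hw hww' => h hw (c.eq.2 (hc (c'.eq.1 hww')))

theorem finite_quotient_of_eq {X : Type} [Finite X] {c : Con (FreeMonoid A)}
    (f : FreeMonoid A → X) (h : ∀ w w', f w = f w' → c w w') : Finite c.Quotient := by
  refine Finite.of_injective (fun p : c.Quotient => f (Quotient.out p)) fun p p' hp => ?_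
  rw [← Quotient.out_eq p, ← Quotient.out_eq p']
  exact c.eq.2 (h _ _ hp)

theorem finite_quotient_inf {c d : Con (FreeMonoid A)} (hc : Finite c.Quotient)
    (hd : Finite d.Quotient) : Finite (c ⊓ d).Quotient := by
  refine finite_quotient_of_eq (fun w => ((w : c.Quotient), (w : d.Quotient))) ?_
  intro w w' h
  exact ⟨c.eq.1 (Prod.ext_iff.1 h).1, d.eq.1 (Prod.ext_iff.1 h).2⟩

theorem Saturates.finite_synCon {c : Con (FreeMonoid A)} {L : Lang A} (h : Saturates c L)
    (hc : Finite c.Quotient) : Finite (synCon L).Quotient := by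
  refine finite_quotient_of_eq (fun w => (w : c.Quotient)) fun w w' hw x y => ⟨?_, ?_⟩
  · exact fun hx => h hx (by simp only [Con.coe_mul, hw])
  · exact fun hx => h hx (by simp only [Con.coe_mul, hw])

theorem IsRegularLang.finite_synCon {L : Lang A} (h : IsRegularLang L) :
    Finite (synCon L).Quotient := by
  obtain ⟨M, _, _, φ, F, rfl⟩ := h
  refine finite_quotient_of_eq φ fun w w' hw x y => ?_
  simp only [Set.mem_preimage, map_mul, hw]

/-- A congruence of finite index all of whose classes belong to `C`. -/
def Admissible (C : LangClass A) (d : Con (FreeMonoid A)) : Prop :=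
  Finite d.Quotient ∧ ∀ z : d.Quotient, {w : FreeMonoid A | (w : d.Quotient) = z} ∈ C

theorem Admissible.inf {C : LangClass A} (hC : IsLatticeClass C) {c d : Con (FreeMonoid A)}
    (hc : Admissible C c) (hd : Admissible C d) : Admissible C (c ⊓ d) := by
  refine ⟨finite_quotient_inf hc.1 hd.1, fun z => ?_⟩
  induction z using Con.induction_on with
  | H w =>
    convert hC.2.2.2 _ _ (hc.2 w) (hd.2 w) using 1
    ext w'
    simp only [Set.mem_inter_iff, Set.mem_ofPred_eq, Con.eq]
    exact Con.inf_iff_and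

theorem IsPrevariety.admissible_synCon {C : LangClass A} (hC : IsPrevariety C) {L : Lang A}
    (hL : L ∈ C) : Admissible C (synCon L) := by
  obtain ⟨⟨⟨-, huniv, -, hinter⟩, hcompl⟩, hquot, hreg⟩ := hC
  have hfin := (hreg L hL).finite_synCon
  refine ⟨hfin, fun z => ?_⟩
  induction z using Con.induction_on with
  | H w =>
  let Q : FreeMonoid A × FreeMonoid A → Lang A := fun p => {u | p.1 * u * p.2 ∈ L}
  have hQ : ∀ p, Q p ∈ C := fun p =>
    (hquot _ (hquot L hL p.1).1 p.2).2 |> fun h => by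
      simpa only [Q, mul_assoc, Set.mem_ofPred_eq] using h
  have hQfin : (Set.range Q).Finite := by
    refine (Set.finite_range fun S : Set (synCon L).Quotient =>
      {w : FreeMonoid A | (w : (synCon L).Quotient) ∈ S}).subset ?_
    rintro _ ⟨p, rfl⟩
    refine ⟨Set.image (fun w : FreeMonoid A => (w : (synCon L).Quotient)) (Q p), ?_⟩
    ext u
    constructor
    · rintro ⟨u', hu', h⟩
      exact (synCon_iff.1 ((synCon L).eq.1 h) p.1 p.2).1 hu'
    · exact fun hu => ⟨u, hu, rfl⟩
  have key : ∀ s : Set (Lang A), s.Finite → s ⊆ Set.range Q →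
      {w' : FreeMonoid A | ∀ K ∈ s, w' ∈ K ↔ w ∈ K} ∈ C := by
    intro s hs
    induction s, hs using Set.Finite.induction_on with
    | empty => intro _; simpa using huniv
    | @insert K s _ _ ih =>
      intro hsub
      have h1 : {w' : FreeMonoid A | w' ∈ K ↔ w ∈ K} ∈ C := by
        obtain ⟨p, rfl⟩ := hsub (Set.mem_insert _ _)
        by_cases hw : w ∈ Q p
        · convert hQ p using 1; ext; simp [hw]
        · convert hcompl _ (hQ p) using 1; ext; simp [hw]
      convert hinter _ _ h1 (ih ((Set.subset_insert _ _).trans hsub)) using 1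
      ext w'
      simp
  convert key _ hQfin subset_rfl using 1
  ext w'
  simp only [Set.mem_ofPred_eq, Con.eq, synCon_iff, Set.forall_mem_range, Prod.forall, Q]

theorem finite_synCon_markedCat {c : Con (FreeMonoid A)} {K L : Lang A} {a : A}
    (hc : Finite c.Quotient) (hK : Saturates c K) (hL : Saturates c L) :
    Finite (synCon (MarkedCat K a L)).Quotient := by
  let f : FreeMonoid A → c.Quotient × Set (c.Quotient × c.Quotient) := fun w =>
    (w, {p | ∃ u v : FreeMonoid A,
      w = u * FreeMonoid.of a * v ∧ p = ((u : c.Quotient), (v : c.Quotient))})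
  have key : ∀ w w', f w = f w' → ∀ x y, x * w * y ∈ MarkedCat K a L →
      x * w' * y ∈ MarkedCat K a L := by
    rintro w w' h x y ⟨p, hp, q, hq, h'⟩
    obtain ⟨hw, hset⟩ := Prod.ext_iff.1 h
    simp only [f] at hw hset
    rcases marked_eq_mul h'.symm with ⟨r, hr, rfl⟩ | ⟨r, rfl, rfl⟩
    · rcases marked_eq_mul hr.symm with ⟨t, rfl, rfl⟩ | ⟨t, rfl, rfl⟩
      · refine ⟨p, hp, t * w' * y, hL hq ?_, by simp only [mul_assoc]⟩
        simp only [Con.coe_mul, hw]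
      · have : ((t : c.Quotient), (r : c.Quotient)) ∈ {p | ∃ u v : FreeMonoid A,
            w' = u * FreeMonoid.of a * v ∧ p = ((u : c.Quotient), (v : c.Quotient))} := by
          rw [← hset]; exact ⟨t, r, rfl, rfl⟩
        obtain ⟨u, v, rfl, huv⟩ := this
        obtain ⟨htu, hrv⟩ := Prod.ext_iff.1 huv
        refine ⟨x * u, hK hp ?_, v * y, hL hq ?_, by simp only [mul_assoc]⟩
        · rw [Con.coe_mul, Con.coe_mul]; exact congrArg _ htu
        · rw [Con.coe_mul, Con.coe_mul]; exact congrArg (· * _) hrv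
    · refine ⟨x * w' * r, hK hp ?_, q, hq, by simp only [mul_assoc]⟩
      simp only [Con.coe_mul, hw]
  exact finite_quotient_of_eq f fun w w' h x y => ⟨key w w' h x y, key w' w h.symm x y⟩

/-! ### Insertion and deletion properties -/

/-- Around a `c`-idempotent `u`, membership in `L` survives the insertion of `v * u` when `v` is
`d`-equivalent to `u`. -/
def Inserts (c d : Con (FreeMonoid A)) (L : Lang A) : Prop :=
  ∀ u v : FreeMonoid A, (u : c.Quotient) * u = u → (u : d.Quotient) = v →
    ∀ x y, x * u * y ∈ L → x * u * v * u * y ∈ L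

/-- The converse of `Inserts`. -/
def Deletes (c d : Con (FreeMonoid A)) (L : Lang A) : Prop :=
  ∀ u v : FreeMonoid A, (u : c.Quotient) * u = u → (u : d.Quotient) = v →
    ∀ x y, x * u * v * u * y ∈ L → x * u * y ∈ L

theorem coe_idem_of_le {c c' : Con (FreeMonoid A)} (hc : c' ≤ c) {u : FreeMonoid A}
    (h : (u : c'.Quotient) * u = u) : (u : c.Quotient) * u = u := by
  rw [← Con.coe_mul, Con.eq] at h ⊢
  exact hc h

theorem coe_eq_of_le {c c' : Con (FreeMonoid A)} (hc : c' ≤ c) {u v : FreeMonoid A}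
    (h : (u : c'.Quotient) = v) : (u : c.Quotient) = v :=
  c.eq.2 (hc (c'.eq.1 h))

theorem Inserts.mono {c c' d d' : Con (FreeMonoid A)} {L : Lang A} (h : Inserts c d L)
    (hc : c' ≤ c) (hd : d' ≤ d) : Inserts c' d' L :=
  fun u v hu huv => h u v (coe_idem_of_le hc hu) (coe_eq_of_le hd huv)

theorem Deletes.mono {c c' d d' : Con (FreeMonoid A)} {L : Lang A} (h : Deletes c d L)
    (hc : c' ≤ c) (hd : d' ≤ d) : Deletes c' d' L :=
  fun u v hu huv => h u v (coe_idem_of_le hc hu) (coe_eq_of_le hd huv)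

theorem Inserts.union {c d : Con (FreeMonoid A)} {K L : Lang A} (hK : Inserts c d K)
    (hL : Inserts c d L) : Inserts c d (K ∪ L) :=
  fun u v hu huv x y => Or.imp (hK u v hu huv x y) (hL u v hu huv x y)

theorem Deletes.union {c d : Con (FreeMonoid A)} {K L : Lang A} (hK : Deletes c d K)
    (hL : Deletes c d L) : Deletes c d (K ∪ L) :=
  fun u v hu huv x y => Or.imp (hK u v hu huv x y) (hL u v hu huv x y)

theorem Inserts.deletes_of_compl {c d : Con (FreeMonoid A)} {L : Lang A}
    (h : Inserts c d Lᶜ) : Deletes c d L :=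
  fun u v hu huv x y hx => by_contra fun hx' => h u v hu huv x y hx' hx

theorem synCon_insert_delete {L : Lang A} :
    Inserts (synCon L) (synCon L) L ∧ Deletes (synCon L) (synCon L) L := by
  have key : ∀ u v : FreeMonoid A, (u : (synCon L).Quotient) * u = u →
      (u : (synCon L).Quotient) = v → ∀ x y : FreeMonoid A,
      ((x * u * y : FreeMonoid A) : (synCon L).Quotient) =
        (x * u * v * u * y : FreeMonoid A) := by
    intro u v hu huv x y
    simp only [Con.coe_mul, ← huv, mul_assoc]
    rw [← mul_assoc (u : (synCon L).Quotient) u, hu, ← mul_assoc (u : (synCon L).Quotient) u, hu]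
  exact ⟨fun u v hu huv x y h => saturates_synCon L h (key u v hu huv x y),
    fun u v hu huv x y h => saturates_synCon L h (key u v hu huv x y).symm⟩

theorem Inserts.markedCat {c c' d : Con (FreeMonoid A)} {K L : Lang A} {a : A} (hc : c' ≤ c)
    (hKc : Saturates c K) (hLc : Saturates c L) (hKL : Saturates c' (MarkedCat K a L))
    (hK : Inserts c d K) (hL : Inserts c d L) : Inserts c' d (MarkedCat K a L) := by
  intro u v hu' huv x y hx
  have hu := coe_idem_of_le hc hu'
  have hua : ∀ z, (u : c.Quotient) * (u * z) = u * z := fun z => by rw [← mul_assoc, hu]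
  have hua' : ∀ z, (u : c'.Quotient) * (u * z) = u * z := fun z => by rw [← mul_assoc, hu']
  have hxx : (x * u) * (u * y) ∈ MarkedCat K a L :=
    hKL hx (by simp only [Con.coe_mul, mul_assoc, hua'])
  obtain ⟨p, hp, q, hq, h⟩ := hxx
  rcases marked_eq_mul h.symm with ⟨r, hr, rfl⟩ | ⟨r, hr, rfl⟩
  · rcases marked_eq_mul hr.symm with ⟨t, rfl, rfl⟩ | ⟨t, ht, rfl⟩
    · refine ⟨p, hp, _, hL u v hu huv t y (hLc hq ?_), by simp only [mul_assoc]⟩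
      simp only [Con.coe_mul, mul_assoc, hua]
    · have hm : x * u * u * v * u * y ∈ MarkedCat K a L :=
        ⟨x * t, hp, _, hL u v hu huv r y (by simpa only [mul_assoc] using hq), by
          nth_rw 1 [ht]; simp only [mul_assoc]⟩
      exact hKL hm (by simp only [Con.coe_mul, mul_assoc, hua'])
  · rcases marked_eq_mul hr.symm with ⟨t, ht, rfl⟩ | ⟨t, rfl, rfl⟩
    · have hm : x * u * v * u * u * y ∈ MarkedCat K a L :=
        ⟨_, hK u v hu huv x r hp, t * y, hq, by nth_rw 3 [ht]; simp only [mul_assoc]⟩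
      exact hKL hm (by simp only [Con.coe_mul, mul_assoc, hua'])
    · refine ⟨_, hK u v hu huv x t (hKc hp ?_), q, hq, by simp only [mul_assoc]⟩
      simp only [Con.coe_mul, mul_assoc, hua]

theorem Unambiguous.false_of_mul {K L : Lang A} {a : A} (h : Unambiguous K a L)
    {z g r t y : FreeMonoid A} (hg : g = r * FreeMonoid.of a * t) (h1 : z * r ∈ K)
    (h2 : t * g * y ∈ L) (h3 : z * g * r ∈ K) (h4 : t * y ∈ L) : False := by
  have := (h _ _ _ _ h1 h3 h2 h4 (by nth_rw 2 [hg]; nth_rw 1 [hg]; simp only [mul_assoc])).1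
  have hl := congrArg FreeMonoid.length this
  have hl' := congrArg FreeMonoid.length hg
  simp only [FreeMonoid.length_mul, FreeMonoid.length_of] at hl hl'
  omega

theorem Deletes.markedCat {c c' d : Con (FreeMonoid A)} {K L : Lang A} {a : A} (hc : c' ≤ c)
    (hamb : Unambiguous K a L)
    (hKc : Saturates c K) (hLc : Saturates c L) (hKL : Saturates c' (MarkedCat K a L))
    (hK : Inserts c d K) (hL : Inserts c d L) (hK' : Deletes c d K) (hL' : Deletes c d L) :
    Deletes c' d (MarkedCat K a L) := by
  intro u v hu' huv x y hx
  have hu := coe_idem_of_le hc hu'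
  have hua : ∀ z, (u : c.Quotient) * (u * z) = u * z := fun z => by rw [← mul_assoc, hu]
  have hua' : ∀ z, (u : c'.Quotient) * (u * z) = u * z := fun z => by rw [← mul_assoc, hu']
  have hins := (hK.markedCat hc hKc hLc hKL hL) u v hu' huv x (v * u * y)
    (by simpa only [mul_assoc] using hx)
  have hK2 : ∀ x y, x * u * v * u * v * u * y ∈ K → x * u * y ∈ K := fun x y h =>
    hK' u v hu huv x y (by
      simpa only [mul_assoc] using hK' u v hu huv x (v * u * y) (by simpa only [mul_assoc] using h))
  have hL2 : ∀ x y, x * u * v * u * v * u * y ∈ L → x * u * y ∈ L := fun x y h =>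
    hL' u v hu huv x y (by
      simpa only [mul_assoc] using hL' u v hu huv x (v * u * y) (by simpa only [mul_assoc] using h))
  obtain ⟨g, hg⟩ : ∃ g, g = u * v * u := ⟨_, rfl⟩
  have hxx : x * (u * (g * (g * (u * y)))) ∈ MarkedCat K a L :=
    hKL hins (by simp only [hg, Con.coe_mul, mul_assoc, hua'])
  have hdouble : x * u * u * y ∈ MarkedCat K a L → x * u * y ∈ MarkedCat K a L := fun h =>
    hKL h (by simp only [Con.coe_mul, mul_assoc, hua'])
  obtain ⟨p, hp, q, hq, h0⟩ := hxx
  rcases marked_eq_mul h0.symm with ⟨r, rfl, rfl⟩ | ⟨r, h1, rfl⟩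
  · refine ⟨p, hp, r * u * y, hL2 r y (hLc hq ?_), by simp only [mul_assoc]⟩
    simp only [hg, Con.coe_mul, mul_assoc, hua]
  rcases marked_eq_mul h1.symm with ⟨t, ht, rfl⟩ | ⟨r, h2, rfl⟩
  · refine hdouble ⟨x * r, hp, t * u * y, hL2 t y (hLc hq ?_), ?_⟩
    · simp only [hg, Con.coe_mul, mul_assoc, hua]
    · nth_rw 1 [ht]; simp only [mul_assoc]
  rcases marked_eq_mul h2.symm with ⟨t, ht, rfl⟩ | ⟨r, h3, rfl⟩
  · have hty : t * u * y ∈ L :=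
      hL' u v hu huv t y (hLc hq (by simp only [hg, Con.coe_mul, mul_assoc, hua]))
    refine (hamb.false_of_mul (z := x * u) (y := u * y) ht (by simpa only [mul_assoc] using hp)
      (by simpa only [mul_assoc] using hq) (hKc (hK u v hu huv x r ?_) ?_)
      (by simpa only [mul_assoc] using hty)).elim
    · simpa only [mul_assoc] using hp
    · simp only [hg, Con.coe_mul, mul_assoc, hua]
  rcases marked_eq_mul h3.symm with ⟨t, ht, rfl⟩ | ⟨r, h4, rfl⟩
  · refine (hamb.false_of_mul (z := x * u) (y := u * y) ht (hK' u v hu huv x r (hKc hp ?_))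
      (hLc (hL u v hu huv t y ?_) ?_) (by simpa only [mul_assoc] using hp)
      (by simpa only [mul_assoc] using hq)).elim
    · simp only [hg, Con.coe_mul, mul_assoc, hua]
    · simpa only [mul_assoc] using hq
    · simp only [hg, Con.coe_mul, mul_assoc, hua]
  rcases marked_eq_mul h4.symm with ⟨t, ht, rfl⟩ | ⟨r, rfl, rfl⟩
  · refine hdouble ⟨x * u * r, hK2 x r (hKc hp ?_), t * y, hq, ?_⟩
    · simp only [hg, Con.coe_mul, mul_assoc, hua]
    · nth_rw 2 [ht]; simp only [mul_assoc]
  · refine ⟨x * u * r, hK2 x r (hKc hp ?_), q, hq, by simp only [mul_assoc]⟩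
    simp only [hg, Con.coe_mul, mul_assoc, hua]

theorem Pol.exists_inserts {C : LangClass A} (hC : IsPrevariety C) {L : Lang A} (h : Pol C L) :
    ∃ c d : Con (FreeMonoid A), Finite c.Quotient ∧ Admissible C d ∧ Saturates c L ∧
      Inserts c d L := by
  induction h with
  | @base L h =>
    exact ⟨_, _, (hC.admissible_synCon h).1, hC.admissible_synCon h, saturates_synCon L,
      synCon_insert_delete.1⟩
  | union _ _ hK hL =>
    obtain ⟨c, d, hc, hd, hs, hi⟩ := hK
    obtain ⟨c', d', hc', hd', hs', hi'⟩ := hL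
    refine ⟨c ⊓ c', d ⊓ d', finite_quotient_inf hc hc', hd.inf hC.1.1 hd', ?_,
      (hi.mono inf_le_left inf_le_left).union (hi'.mono inf_le_right inf_le_right)⟩
    exact fun hw h => hw.imp (fun hw => hs.mono inf_le_left hw h)
      (fun hw => hs'.mono inf_le_right hw h)
  | @mcat K L a _ _ hK hL =>
    obtain ⟨c, d, hc, hd, hs, hi⟩ := hK
    obtain ⟨c', d', hc', hd', hs', hi'⟩ := hL
    have hfin := finite_quotient_inf hc hc'
    have hK : Saturates (c ⊓ c') K := hs.mono inf_le_left
    have hL : Saturates (c ⊓ c') L := hs'.mono inf_le_right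
    have hsyn := finite_synCon_markedCat (a := a) hfin hK hL
    have hsat : Saturates (c ⊓ c' ⊓ synCon (MarkedCat K a L)) (MarkedCat K a L) :=
      Saturates.mono (saturates_synCon _) inf_le_right
    exact ⟨c ⊓ c' ⊓ synCon (MarkedCat K a L), d ⊓ d', finite_quotient_inf hfin hsyn,
      hd.inf hC.1.1 hd', hsat,
      (hi.mono inf_le_left inf_le_left).markedCat inf_le_left hK hL hsat
        (hi'.mono inf_le_right inf_le_right)⟩

theorem UPol.exists_inserts_deletes {C : LangClass A} (hC : IsPrevariety C) {L : Lang A}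
    (h : UPol C L) :
    ∃ c d : Con (FreeMonoid A), Finite c.Quotient ∧ Admissible C d ∧ Saturates c L ∧
      Inserts c d L ∧ Deletes c d L := by
  induction h with
  | @base L h =>
    exact ⟨_, _, (hC.admissible_synCon h).1, hC.admissible_synCon h, saturates_synCon L,
      synCon_insert_delete⟩
  | disjUnion _ _ _ hK hL =>
    obtain ⟨c, d, hc, hd, hs, hi, hdel⟩ := hK
    obtain ⟨c', d', hc', hd', hs', hi', hdel'⟩ := hL
    refine ⟨c ⊓ c', d ⊓ d', finite_quotient_inf hc hc', hd.inf hC.1.1 hd', ?_,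
      (hi.mono inf_le_left inf_le_left).union (hi'.mono inf_le_right inf_le_right),
      (hdel.mono inf_le_left inf_le_left).union (hdel'.mono inf_le_right inf_le_right)⟩
    exact fun hw h => hw.imp (fun hw => hs.mono inf_le_left hw h)
      (fun hw => hs'.mono inf_le_right hw h)
  | @mcat K L a _ _ hamb hK hL =>
    obtain ⟨c, d, hc, hd, hs, hi, hdel⟩ := hK
    obtain ⟨c', d', hc', hd', hs', hi', hdel'⟩ := hL
    have hfin := finite_quotient_inf hc hc'
    have hK : Saturates (c ⊓ c') K := hs.mono inf_le_left
    have hL : Saturates (c ⊓ c') L := hs'.mono inf_le_right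
    have hsyn := finite_synCon_markedCat (a := a) hfin hK hL
    have hsat : Saturates (c ⊓ c' ⊓ synCon (MarkedCat K a L)) (MarkedCat K a L) :=
      Saturates.mono (saturates_synCon _) inf_le_right
    have hiK : Inserts (c ⊓ c') (d ⊓ d') K := hi.mono inf_le_left inf_le_left
    have hiL : Inserts (c ⊓ c') (d ⊓ d') L := hi'.mono inf_le_right inf_le_right
    exact ⟨c ⊓ c' ⊓ synCon (MarkedCat K a L), d ⊓ d', finite_quotient_inf hfin hsyn,
      hd.inf hC.1.1 hd', hsat, hiK.markedCat inf_le_left hK hL hsat hiL,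
      Deletes.markedCat inf_le_left hamb hK hL hsat hiK hiL (hdel.mono inf_le_left inf_le_left)
        (hdel'.mono inf_le_right inf_le_right)⟩

theorem coe_pow_quotient (c : Con (FreeMonoid A)) (u : FreeMonoid A) (n : ℕ) :
    ((u ^ n : FreeMonoid A) : c.Quotient) = (u : c.Quotient) ^ n :=
  map_pow c.mk' u n

theorem locallyTrivial_synCon {c d : Con (FreeMonoid A)} {L : Lang A} (hc : Finite c.Quotient)
    (hi : Inserts c d L) (hdel : Deletes c d L) :
    LocallyTrivial (Con.map (synCon L ⊓ d) d inf_le_right) := by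
  intro e t
  induction e, t using Con.induction_on₂ with
  | H u v =>
  intro he ht
  have huv : (u : d.Quotient) = v := Eq.symm ht
  have hus := coe_idem_of_le inf_le_left he
  have hud := coe_idem_of_le inf_le_right he
  obtain ⟨n, hn⟩ := exists_idempotent_pow (u : c.Quotient)
  have hn' : ((u ^ (n + 1) : FreeMonoid A) : c.Quotient) * (u ^ (n + 1) : FreeMonoid A) =
      (u ^ (n + 1) : FreeMonoid A) := by simpa only [coe_pow_quotient] using hn
  have hpow : ((u ^ (n + 1) : FreeMonoid A) : d.Quotient) = (u ^ n * v : FreeMonoid A) := by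
    rw [pow_succ, Con.coe_mul, Con.coe_mul, huv]
  have hsyn : ((u ^ (n + 1) : FreeMonoid A) : (synCon L).Quotient) =
      (u ^ (n + 1) * (u ^ n * v) * u ^ (n + 1) : FreeMonoid A) := by
    refine (synCon L).eq.2 (synCon_iff.2 fun x y => ⟨fun h => ?_, fun h => ?_⟩)
    · simpa only [mul_assoc] using hi _ _ hn' hpow x y h
    · exact hdel _ _ hn' hpow x y (by simpa only [mul_assoc] using h)
  have hup : ∀ k : ℕ, (u : (synCon L).Quotient) ^ (k + 1) = u := fun k =>
    IsIdempotentElem.pow_succ_eq k hus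
  have hs' : (u : (synCon L).Quotient) * v * u = u := by
    simp only [Con.coe_mul, coe_pow_quotient, hup] at hsyn
    rw [← mul_assoc, ← pow_succ', hup] at hsyn
    exact hsyn.symm
  rw [← Con.coe_mul, ← Con.coe_mul, Con.eq]
  refine ⟨(synCon L).eq.1 (by simpa only [Con.coe_mul] using hs'), d.eq.1 ?_⟩
  rw [Con.coe_mul, Con.coe_mul, ← huv, hud, hud]

theorem upol_of_inserts_deletes [Finite A] {C : LangClass A} (hC : IsPrevariety C)
    {c d : Con (FreeMonoid A)} {L : Lang A} (hc : Finite c.Quotient) (hd : Admissible C d)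
    (hs : Saturates c L) (hi : Inserts c d L) (hdel : Deletes c d L) :
    UPol C L ∧ UPol C Lᶜ := by
  have := hd.1
  have := finite_quotient_inf (hs.finite_synCon hc) hd.1
  have hsurj : Function.Surjective (Con.map (synCon L ⊓ d) d inf_le_right) := by
    intro z
    induction z using Con.induction_on with
    | H w => exact ⟨w, rfl⟩
  have hup := (locallyTrivial_synCon hc hi hdel).upol_preimage (α := (synCon L ⊓ d).mk')
    hsurj hC.1.1 hd.2
  have hL : L = (synCon L ⊓ d).mk' ⁻¹' Set.image (synCon L ⊓ d).mk' L := by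
    ext w
    refine ⟨fun h => ⟨w, h, rfl⟩, ?_⟩
    rintro ⟨w', hw', h⟩
    exact Saturates.mono (saturates_synCon L) inf_le_left hw' h
  rw [hL]
  exact ⟨hup _, hup (_)ᶜ⟩

theorem upol_iff_pol_and_pol_compl [Finite A] {C : LangClass A} (hC : IsPrevariety C)
    (L : Lang A) : UPol C L ↔ Pol C L ∧ Pol C Lᶜ := by
  constructor
  · intro h
    obtain ⟨c, d, hc, hd, hs, hi, hdel⟩ := h.exists_inserts_deletes hC
    exact ⟨h.pol, (upol_of_inserts_deletes hC hc hd hs hi hdel).2.pol⟩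
  · rintro ⟨h, h'⟩
    obtain ⟨c, d, hc, hd, hs, hi⟩ := h.exists_inserts hC
    obtain ⟨c', d', hc', hd', hs', hi'⟩ := h'.exists_inserts hC
    exact (upol_of_inserts_deletes hC (finite_quotient_inf hc hc') (hd.inf hC.1.1 hd')
      (hs.mono inf_le_left) (hi.mono inf_le_left inf_le_left)
      (hi'.mono inf_le_right inf_le_right).deletes_of_compl).1

/-- For a prevariety `C`, the unambiguous polynomial closure equals the
intersected polynomial closure: `UPol C = Pol C ∩ coPol C`; that is, `L ∈ UPol C` iff
both `L` and its complement belong to `Pol C`. -/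
theorem upol_eq_pol_inter_copol {A : Type} [Fintype A] (C : LangClass A)
    (hC : IsPrevariety C) :
    {L : Lang A | UPol C L} = {L : Lang A | Pol C L} ∩ coPol C ∧
      ∀ L : Lang A, UPol C L ↔ Pol C L ∧ Pol C Lᶜ := by
  refine ⟨?_, upol_iff_pol_and_pol_compl hC⟩
  ext L
  simp only [Set.mem_ofPred_eq, Set.mem_inter_iff, upol_iff_pol_and_pol_compl hC, coPol]
  refine and_congr_right fun _ => ⟨fun h => ⟨Lᶜ, h, (compl_compl L).symm⟩, ?_⟩
  rintro ⟨K, hK, rfl⟩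
  rwa [compl_compl]

end RegLang
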